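/- The right-derivative of the scale function satisfies W′(t) ≤ 1/c for every t ∈ ℝ (with W′ = 0 on (−∞,0)). -/

import Mathlib

open MeasureTheory Real Set Filter Topology

noncomputable def tailNu (ν : Measure ℝ) (y : ℝ) : ℝ := (ν (Set.Ici y)).toReal

noncomputable def itailNu (ν : Measure ℝ) (x : ℝ) : ℝ := ∫ y in Set.Ioi x, tailNu ν y

noncomputable def phi (b c : ℝ) (ν : Measure ℝ) (l : ℝ) : ℝ :=
  b * l + c * l ^ 2 + ∫ y in Set.Ioi (0 : ℝ), (Real.exp (-l * y) - 1 + l * y) ∂ν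


open scoped ENNReal

noncomputable def lapm (μ : Measure ℝ) (l : ℝ) : ℝ≥0∞ :=
  ∫⁻ x, ENNReal.ofReal (Real.exp (-l * x)) ∂μ

lemma lapm_tilt (μ : Measure ℝ) (t : ℝ) :
    ∫⁻ x, ENNReal.ofReal (Real.exp (t * x))
      ∂(μ.withDensity (fun x => ENNReal.ofReal (Real.exp (-x)))) = lapm μ (1 - t) := by
  rw [lintegral_withDensity_eq_lintegral_mul _ (by fun_prop) (by fun_prop)]
  unfold lapm
  congr 1 with x
  simp only [Pi.mul_apply]
  rw [← ENNReal.ofReal_mul (Real.exp_nonneg _), ← Real.exp_add]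
  congr 2; ring

lemma lapm_unique (μ μ' : Measure ℝ) (hfin : ∀ l, 0 < l → lapm μ l ≠ ⊤)
    (h : ∀ l, lapm μ l = lapm μ' l) : μ = μ' := by
  set f : ℝ → ℝ≥0∞ := fun x => ENNReal.ofReal (Real.exp (-x)) with hf
  have hfm : Measurable f := by fun_prop
  have key : μ.withDensity f = μ'.withDensity f := by
    have fin1 : ∀ ρ : Measure ℝ, lapm ρ 1 ≠ ⊤ → IsFiniteMeasure (ρ.withDensity f) := by
      intro ρ hρ
      apply isFiniteMeasure_withDensity
      simpa [lapm] using hρ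
    have := fin1 μ (hfin 1 one_pos)
    have := fin1 μ' (h 1 ▸ hfin 1 one_pos)
    have hm : ∀ (ρ : Measure ℝ) t, ProbabilityTheory.mgf id (ρ.withDensity f) t
        = (lapm ρ (1 - t)).toReal := by
      intro ρ t
      unfold ProbabilityTheory.mgf
      rw [integral_eq_lintegral_of_nonneg_ae
        (Eventually.of_forall fun x => (Real.exp_nonneg _)) (by fun_prop)]
      simp only [id]
      rw [lapm_tilt]
    have hmgf : ProbabilityTheory.mgf id (μ.withDensity f)
        = ProbabilityTheory.mgf id (μ'.withDensity f) := by
      funext t; rw [hm, hm, h]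
    have hint : Iio (1:ℝ) ⊆ ProbabilityTheory.integrableExpSet id (μ.withDensity f) := by
      intro t ht
      show Integrable _ _
      refine ⟨by fun_prop, ?_⟩
      rw [hasFiniteIntegral_iff_ofReal (Eventually.of_forall fun x => (Real.exp_nonneg _))]
      simp only [id]
      rw [lapm_tilt]
      exact (hfin _ (sub_pos.2 ht)).lt_top
    have h0 : (0:ℝ) ∈ interior (ProbabilityTheory.integrableExpSet id (μ.withDensity f)) :=
      interior_maximal hint isOpen_Iio (by simp)
    have hz : ∀ (ρ : Measure ℝ), (IsFiniteMeasure (ρ.withDensity f)) →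
        (ρ.withDensity f = 0 ↔ lapm ρ 1 = 0) := by
      intro ρ _
      rw [← Measure.measure_univ_eq_zero, withDensity_apply _ MeasurableSet.univ]
      simp [lapm, hf]
    have hE := ProbabilityTheory.eqOn_complexMGF_of_mgf' hmgf
      (by rw [hz μ inferInstance, hz μ' inferInstance, h])
    apply Measure.ext_of_charFun
    funext t
    rw [← ProbabilityTheory.complexMGF_id_mul_I, ← ProbabilityTheory.complexMGF_id_mul_I]
    apply hE
    simpa using h0
  have hne : ∀ x, f x ≠ 0 := fun x => by simp [hf, Real.exp_pos]
  have hnt : ∀ x, f x ≠ ⊤ := fun x => by simp [hf]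
  rw [← withDensity_inv_same (μ := μ) hfm (Eventually.of_forall hne) (Eventually.of_forall hnt), key,
    withDensity_inv_same (μ := μ') hfm (Eventually.of_forall hne) (Eventually.of_forall hnt)]

lemma lapm_anti {μ : Measure ℝ} (hμ : ∀ᵐ x ∂μ, 0 < x) {l l' : ℝ} (h : l ≤ l') :
    lapm μ l' ≤ lapm μ l := by
  apply lintegral_mono_ae
  filter_upwards [hμ] with x hx
  apply ENNReal.ofReal_le_ofReal
  apply Real.exp_le_exp.2
  nlinarith

lemma lapm_conv (μ μ' : Measure ℝ) [SFinite μ] [SFinite μ'] (l : ℝ) :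
    lapm (μ.conv μ') l = lapm μ l * lapm μ' l := by
  unfold lapm
  rw [Measure.lintegral_conv (by fun_prop)]
  rw [← lintegral_mul_const _ (by fun_prop)]
  congr 1 with x
  rw [← lintegral_const_mul _ (by fun_prop)]
  congr 1 with y
  rw [← ENNReal.ofReal_mul (Real.exp_nonneg _), ← Real.exp_add]
  congr 2; ring

lemma lint_exp_Ioi {l : ℝ} (hl : 0 < l) (s : ℝ) :
    ∫⁻ x in Ioi s, ENNReal.ofReal (Real.exp (-l * x)) = ENNReal.ofReal (Real.exp (-l * s) / l) := by
  rw [← ofReal_integral_eq_lintegral_ofReal]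
  · rw [integral_exp_mul_Ioi (by linarith)]
    congr 1; field_simp
  · exact integrableOn_exp_mul_Ioi (by linarith) s
  · exact Eventually.of_forall fun x => (Real.exp_nonneg _)

lemma lapm_vol {l : ℝ} (hl : 0 < l) :
    lapm (volume.restrict (Ioi (0:ℝ))) l = ENNReal.ofReal (1 / l) := by
  unfold lapm
  rw [lint_exp_Ioi hl]; simp

lemma lapm_dens (g : ℝ → ℝ≥0∞) (hg : Measurable g) (l : ℝ) :
    lapm ((volume.restrict (Ioi (0:ℝ))).withDensity g) l
      = ∫⁻ x in Ioi (0:ℝ), g x * ENNReal.ofReal (Real.exp (-l * x)) := by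
  unfold lapm
  rw [lintegral_withDensity_eq_lintegral_mul _ hg (by fun_prop)]
  rfl

lemma dens_pos (g : ℝ → ℝ≥0∞) :
    ∀ᵐ x ∂((volume.restrict (Ioi (0:ℝ))).withDensity g), 0 < x :=
  (withDensity_absolutelyContinuous _ _).ae_le (ae_restrict_mem measurableSet_Ioi)

lemma lint_kernel {l : ℝ} (hl : 0 < l) {y : ℝ} (hy : 0 < y) :
    ∫⁻ x in Ioi (0:ℝ), ENNReal.ofReal (y - x) * ENNReal.ofReal (Real.exp (-l * x))
      = ENNReal.ofReal ((Real.exp (-l * y) - 1 + l * y) / l ^ 2) := by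
  have e1 : ∫⁻ x in Ioi (0:ℝ), ENNReal.ofReal (y - x) * ENNReal.ofReal (Real.exp (-l * x))
      = ∫⁻ x in Ioc 0 y, ENNReal.ofReal ((y - x) * Real.exp (-l * x)) := by
    rw [← lintegral_indicator measurableSet_Ioi, ← lintegral_indicator measurableSet_Ioc]
    congr 1 with x
    by_cases h0 : 0 < x
    · by_cases hxy : x ≤ y
      · simp [indicator, h0, hxy, ENNReal.ofReal_mul (sub_nonneg.2 hxy)]
      · simp only [indicator, mem_Ioi, h0, mem_Ioc, hxy]
        simp [ENNReal.ofReal_of_nonpos (show y - x ≤ 0 by linarith [not_le.1 hxy])]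
    · simp [indicator, h0]
  rw [e1, ← ofReal_integral_eq_lintegral_ofReal]
  · rw [← intervalIntegral.integral_of_le hy.le,
      intervalIntegral.integral_eq_sub_of_hasDerivAt (f := fun x =>
        -(Real.exp (-l * x) * (y - x) / l) + Real.exp (-l * x) / l ^ 2)]
    · congr 1; simp; field_simp; ring
    · intro x _
      have h1 : HasDerivAt (fun x => Real.exp (-l * x)) (Real.exp (-l * x) * (-l * 1)) x :=
        ((hasDerivAt_id x).const_mul (-l)).exp
      have h2 : HasDerivAt (fun x => y - x) (-1) x := (hasDerivAt_id x).const_sub y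
      refine HasDerivAt.congr_deriv (((h1.mul h2).div_const l).neg.add (h1.div_const (l ^ 2))) ?_
      field_simp; ring
    · exact (by fun_prop : Continuous _).intervalIntegrable _ _
  · exact (by fun_prop : Continuous _).integrableOn_Ioc
  · filter_upwards [ae_restrict_mem measurableSet_Ioc] with x hx
    exact mul_nonneg (sub_nonneg.2 hx.2) (Real.exp_nonneg _)

lemma sfinite_nu (ν : Measure ℝ)
    (hνint : ∫⁻ y in Set.Ioi (0 : ℝ), ENNReal.ofReal (min y (y ^ 2)) ∂ν ≠ ⊤) :
    SFinite (ν.restrict (Ioi 0)) := by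
  have hm : Measurable fun y : ℝ => ENNReal.ofReal (min y (y ^ 2)) := by fun_prop
  have := isFiniteMeasure_withDensity hνint
  rw [← withDensity_inv_same (μ := ν.restrict (Ioi 0)) hm ?_ (Eventually.of_forall fun x => by simp)]
  · infer_instance
  · filter_upwards [ae_restrict_mem measurableSet_Ioi] with x hx
    have hx : 0 < x := hx
    have : 0 < min x (x ^ 2) := lt_min hx (by positivity)
    simp only [ne_eq, ENNReal.ofReal_eq_zero, not_le]; exact this

lemma integrable_phi (ν : Measure ℝ)
    (hνint : ∫⁻ y in Set.Ioi (0 : ℝ), ENNReal.ofReal (min y (y ^ 2)) ∂ν ≠ ⊤) {l : ℝ} (hl : 0 < l) :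
    IntegrableOn (fun y => Real.exp (-l * y) - 1 + l * y) (Ioi 0) ν := by
  have h1 : IntegrableOn (fun y : ℝ => min y (y ^ 2)) (Ioi 0) ν := by
    refine ⟨by fun_prop, ?_⟩
    rw [hasFiniteIntegral_iff_ofReal]
    · exact hνint.lt_top
    · filter_upwards [ae_restrict_mem measurableSet_Ioi] with x hx
      have hx : 0 < x := hx
      exact le_min hx.le (by positivity)
  refine (h1.const_mul (l + l ^ 2)).mono' (by fun_prop) ?_
  filter_upwards [ae_restrict_mem measurableSet_Ioi] with x hx
  have hx : 0 < x := hx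
  have hlx : 0 < l * x := mul_pos hl hx
  have n0 : 0 ≤ Real.exp (-l * x) - 1 + l * x := by linarith [Real.add_one_le_exp (-l * x)]
  rw [Real.norm_of_nonneg n0]
  have a1 : Real.exp (-l * x) ≤ 1 := Real.exp_le_one_iff.2 (by linarith)
  have a2 : Real.exp (-l * x) - 1 + l * x ≤ (l * x) ^ 2 := by
    have : Real.exp (-l * x) ≤ 1 / (1 + l * x) := by
      rw [show -l * x = -(l * x) by ring, Real.exp_neg, ← one_div]
      exact one_div_le_one_div_of_le (by linarith) (by linarith [Real.add_one_le_exp (l * x)])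
    have h3 : 1 / (1 + l * x) ≤ 1 - l * x + (l * x) ^ 2 := by
      rw [div_le_iff₀ (by linarith)]
      nlinarith [pow_pos hlx 3]
    linarith
  rcases min_choice x (x ^ 2) with h | h <;> rw [h]
  · nlinarith [mul_pos (pow_pos hl 2) hx]
  · nlinarith [mul_pos hl (pow_pos hx 2)]

lemma lapm_kappa (ν : Measure ℝ)
    (hνint : ∫⁻ y in Set.Ioi (0 : ℝ), ENNReal.ofReal (min y (y ^ 2)) ∂ν ≠ ⊤) {l : ℝ} (hl : 0 < l) :
    lapm ((volume.restrict (Ioi (0:ℝ))).withDensity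
      (fun x => ∫⁻ y in Ioi (0:ℝ), ENNReal.ofReal (y - x) ∂ν)) l
      = ENNReal.ofReal ((∫ y in Ioi (0:ℝ), (Real.exp (-l * y) - 1 + l * y) ∂ν) / l ^ 2) := by
  have := sfinite_nu ν hνint
  have hm : Measurable fun p : ℝ × ℝ => ENNReal.ofReal (p.2 - p.1) := by fun_prop
  rw [lapm_dens _ hm.lintegral_prod_right']
  have e : ∀ x, (∫⁻ y in Ioi (0:ℝ), ENNReal.ofReal (y - x) ∂ν) * ENNReal.ofReal (Real.exp (-l * x))
      = ∫⁻ y in Ioi (0:ℝ), ENNReal.ofReal (y - x) * ENNReal.ofReal (Real.exp (-l * x)) ∂ν := by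
    intro x
    rw [lintegral_mul_const _ (by fun_prop)]
  simp_rw [e]
  rw [lintegral_lintegral_swap (by fun_prop)]
  rw [← integral_div, ofReal_integral_eq_lintegral_ofReal]
  · apply lintegral_congr_ae
    filter_upwards [ae_restrict_mem measurableSet_Ioi] with y hy
    exact lint_kernel hl hy
  · exact (integrable_phi ν hνint hl).div_const _
  · refine Eventually.of_forall fun y => ?_
    exact div_nonneg (by linarith [Real.add_one_le_exp (-l * y)]) (by positivity)

lemma lapm_W' {W W' : ℝ → ℝ} (hW : Measurable W) (hW' : Measurable W')
    (hFTC : ∀ x, 0 < x → ∫⁻ s in Ioc 0 x, ENNReal.ofReal (W' s) = ENNReal.ofReal (W x))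
    {l : ℝ} (hl : 0 < l) :
    lapm ((volume.restrict (Ioi (0:ℝ))).withDensity (fun x => ENNReal.ofReal (W x))) l
    = ENNReal.ofReal (1 / l) *
      lapm ((volume.restrict (Ioi (0:ℝ))).withDensity (fun x => ENNReal.ofReal (W' x))) l := by
  rw [lapm_dens _ (by fun_prop), lapm_dens _ (by fun_prop)]
  have e : ∫⁻ x in Ioi (0:ℝ), ENNReal.ofReal (W x) * ENNReal.ofReal (Real.exp (-l * x))
      = ∫⁻ x in Ioi (0:ℝ), ∫⁻ s in Ioi (0:ℝ),
        (ENNReal.ofReal (W' s) * ENNReal.ofReal (Real.exp (-l * x))) *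
          ({p : ℝ × ℝ | p.2 ≤ p.1}.indicator 1 (x, s)) := by
    apply setLIntegral_congr_fun measurableSet_Ioi
    intro x hx
    simp only
    rw [← hFTC x hx, ← lintegral_mul_const _ (by fun_prop), ← lintegral_indicator measurableSet_Ioc,
      ← lintegral_indicator measurableSet_Ioi]
    congr 1 with s
    by_cases h0 : 0 < s <;> by_cases hsx : s ≤ x <;> simp [indicator, h0, hsx]
  rw [e, lintegral_lintegral_swap]
  · rw [← lintegral_const_mul _ (by fun_prop)]
    apply setLIntegral_congr_fun measurableSet_Ioi
    intro s hs
    have hs : 0 < s := hs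
    simp only
    have e2 : ∫⁻ x in Ioi (0:ℝ),
        (ENNReal.ofReal (W' s) * ENNReal.ofReal (Real.exp (-l * x))) *
          ({p : ℝ × ℝ | p.2 ≤ p.1}.indicator 1 (x, s))
        = ∫⁻ x in Ici s, ENNReal.ofReal (W' s) * ENNReal.ofReal (Real.exp (-l * x)) := by
      rw [← lintegral_indicator measurableSet_Ioi, ← lintegral_indicator measurableSet_Ici]
      congr 1 with x
      by_cases hsx : s ≤ x
      · simp [indicator, hsx, hs.trans_le hsx]
      · simp [indicator, hsx]
    rw [e2, lintegral_const_mul _ (by fun_prop), setLIntegral_congr Ioi_ae_eq_Ici.symm, lint_exp_Ioi hl,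
      mul_left_comm, ← ENNReal.ofReal_mul (one_div_pos.2 hl).le (q := Real.exp (-l * s))]
    congr 2; ring
  · have : MeasurableSet {p : ℝ × ℝ | p.2 ≤ p.1} := measurableSet_le measurable_snd measurable_fst
    refine Measurable.aemeasurable ?_
    exact Measurable.mul (by fun_prop) (measurable_one.indicator this)

lemma main_aux
    (b c : ℝ) (hb : 0 ≤ b) (hc : 0 < c)
    (ν : Measure ℝ)
    (hνint : ∫⁻ y in Set.Ioi (0 : ℝ), ENNReal.ofReal (min y (y ^ 2)) ∂ν ≠ ⊤)
    (W W' : ℝ → ℝ)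
    (hWneg : ∀ x : ℝ, x < 0 → W x = 0)
    (hWnonneg : ∀ x : ℝ, 0 ≤ W x)
    (hWcont : ContinuousOn W (Set.Ici 0))
    (hWmono : StrictMonoOn W (Set.Ici 0))
    (hWlap : ∀ l : ℝ, 0 < l →
      (∫ x in Set.Ioi (0 : ℝ), Real.exp (-l * x) * W x) = 1 / phi b c ν l)
    (hW'neg : ∀ x : ℝ, x < 0 → W' x = 0)
    (hW'deriv : ∀ x : ℝ, 0 < x → HasDerivAt W (W' x) x)
    (hW'cont : ContinuousOn W' (Set.Ici 0)) :
    ∀ t : ℝ, 0 < t → W' t ≤ 1 / c := by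
  have meas : ∀ f : ℝ → ℝ, (∀ x, x < 0 → f x = 0) → ContinuousOn f (Ici 0) → Measurable f := by
    intro f hf hcont
    have : f = (Ici (0:ℝ)).piecewise f 0 := by
      funext x
      by_cases h : 0 ≤ x
      · simp [piecewise, h]
      · simp [piecewise, h, hf x (not_le.1 h)]
    rw [this]
    exact ContinuousOn.measurable_piecewise hcont continuousOn_const measurableSet_Ici
  have mW := meas W hWneg hWcont
  have mW' := meas W' hW'neg hW'cont
  have hW'nn : ∀ x, 0 < x → 0 ≤ W' x := by
    intro x hx
    have h1 : derivWithin W (Ici 0) x = W' x :=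
      (hW'deriv x hx).hasDerivWithinAt.derivWithin (uniqueDiffOn_Ici 0 x hx.le)
    rw [← h1]
    exact hWmono.monotoneOn.derivWithin_nonneg
  set I : ℝ → ℝ := fun l => ∫ y in Ioi (0:ℝ), (Real.exp (-l * y) - 1 + l * y) ∂ν with hI
  have hInn : ∀ l, 0 ≤ I l := fun l =>
    integral_nonneg fun y => by
      show 0 ≤ Real.exp (-l * y) - 1 + l * y
      linarith [Real.add_one_le_exp (-l * y)]
  have hphi : ∀ l, phi b c ν l = b * l + c * l ^ 2 + I l := fun l => rfl
  have hphige : ∀ l, 0 < l → c * l ^ 2 ≤ phi b c ν l := by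
    intro l hl; rw [hphi]; nlinarith [hInn l, mul_nonneg hb hl.le]
  have hphipos : ∀ l, 0 < l → 0 < phi b c ν l := fun l hl =>
    lt_of_lt_of_le (by positivity) (hphige l hl)
  have hWint : ∀ l, 0 < l → IntegrableOn (fun x => Real.exp (-l * x) * W x) (Ioi 0) := by
    intro l hl
    apply Integrable.of_integral_ne_zero
    rw [hWlap l hl]
    exact (one_div_pos.2 (hphipos l hl)).ne'
  have hW0 : W 0 = 0 := by
    have key : ∀ l, 0 < l → W 0 * l * c ≤ 1 := by
      intro l hl
      have h1 : ∫ x in Ioi (0:ℝ), Real.exp (-l * x) * W 0 ≤ 1 / phi b c ν l := by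
        rw [← hWlap l hl]
        apply setIntegral_mono_on _ (hWint l hl) measurableSet_Ioi
        · intro x hx
          exact mul_le_mul_of_nonneg_left
            (hWmono.monotoneOn (by simp) (mem_Ici.2 (le_of_lt hx)) (le_of_lt hx)) (Real.exp_nonneg _)
        · exact (integrableOn_exp_mul_Ioi (by linarith) 0).mul_const _
      rw [integral_mul_const, integral_exp_mul_Ioi (by linarith)] at h1
      have h2 : 1 / phi b c ν l ≤ 1 / (c * l ^ 2) :=
        one_div_le_one_div_of_le (by positivity) (hphige l hl)
      have h3 := h1.trans h2
      have h4 : -Real.exp (-l * 0) / -l * W 0 = W 0 * l * c / (c * l ^ 2) := by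
        simp; field_simp
      rw [h4] at h3
      exact (div_le_div_iff_of_pos_right (by positivity)).1 h3
    by_contra hne
    have hpos : 0 < W 0 := lt_of_le_of_ne (hWnonneg 0) (Ne.symm hne)
    have := key (2 / (W 0 * c)) (by positivity)
    have h5 : W 0 * (2 / (W 0 * c)) * c = 2 := by field_simp
    linarith
  have hFTC : ∀ x, 0 < x → ∫⁻ s in Ioc 0 x, ENNReal.ofReal (W' s) = ENNReal.ofReal (W x) := by
    intro x hx
    have hsub : Icc 0 x ⊆ Ici (0:ℝ) := fun y hy => hy.1
    have hii : IntervalIntegrable W' volume 0 x :=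
      (hW'cont.mono (by rw [uIcc_of_le hx.le]; exact hsub)).intervalIntegrable
    rw [← ofReal_integral_eq_lintegral_ofReal]
    · rw [← intervalIntegral.integral_of_le hx.le,
        intervalIntegral.integral_eq_sub_of_hasDerivAt_of_le hx.le (hWcont.mono hsub)
          (fun y hy => hW'deriv y hy.1) hii, hW0, sub_zero]
    · exact (intervalIntegrable_iff_integrableOn_Ioc_of_le hx.le).1 hii
    · filter_upwards [ae_restrict_mem measurableSet_Ioc] with y hy
      exact hW'nn y hy.1
  set MW := (volume.restrict (Ioi (0:ℝ))).withDensity (fun x => ENNReal.ofReal (W x)) with hMW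
  set B := (volume.restrict (Ioi (0:ℝ))).withDensity (fun x => ENNReal.ofReal (W' x)) with hB
  set K := (volume.restrict (Ioi (0:ℝ))).withDensity
      (fun x => ∫⁻ y in Ioi (0:ℝ), ENNReal.ofReal (y - x) ∂ν) with hK
  have lMW : ∀ l, 0 < l → lapm MW l = ENNReal.ofReal (1 / phi b c ν l) := by
    intro l hl
    rw [hMW, lapm_dens _ (by fun_prop), ← hWlap l hl, ofReal_integral_eq_lintegral_ofReal (hWint l hl)]
    · congr 1 with x
      rw [mul_comm, ENNReal.ofReal_mul (Real.exp_nonneg _)]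
    · exact Eventually.of_forall fun x => mul_nonneg (Real.exp_nonneg _) (hWnonneg x)
  have lB : ∀ l, 0 < l → lapm B l = ENNReal.ofReal (l / phi b c ν l) := by
    intro l hl
    have h := lapm_W' mW mW' hFTC hl
    rw [← hMW, ← hB, lMW l hl] at h
    calc lapm B l = ENNReal.ofReal l * (ENNReal.ofReal (1 / l) * lapm B l) := by
          rw [← mul_assoc, ← ENNReal.ofReal_mul hl.le, mul_one_div_cancel hl.ne']; simp
      _ = _ := by
          rw [← h, ← ENNReal.ofReal_mul hl.le]; congr 1; ring
  have lK : ∀ l, 0 < l → lapm K l = ENNReal.ofReal (I l / l ^ 2) := fun l hl =>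
    lapm_kappa ν hνint hl
  set M := ENNReal.ofReal c • B + (ENNReal.ofReal b • MW + K.conv B) with hM
  have lM : ∀ l, lapm M l = ENNReal.ofReal c * lapm B l +
      (ENNReal.ofReal b * lapm MW l + lapm K l * lapm B l) := by
    intro l
    rw [← lapm_conv K B l]
    simp [lapm, hM]
  have lMpos : ∀ l, 0 < l → lapm M l = ENNReal.ofReal (1 / l) := by
    intro l hl
    have hp := hphipos l hl
    have hi := hInn l
    rw [lM, lB l hl, lMW l hl, lK l hl, ← ENNReal.ofReal_mul hc.le, ← ENNReal.ofReal_mul hb,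
      ← ENNReal.ofReal_mul (by positivity), ← ENNReal.ofReal_add (by positivity) (by positivity),
      ← ENNReal.ofReal_add (by positivity) (by positivity)]
    congr 1
    have := hphi l
    field_simp
    rw [this]; ring
  have lManti : ∀ l l', l ≤ l' → lapm M l' ≤ lapm M l := by
    intro l l' h
    rw [lM, lM]
    have h1 : lapm B l' ≤ lapm B l := lapm_anti (dens_pos _) h
    have h2 : lapm MW l' ≤ lapm MW l := lapm_anti (dens_pos _) h
    have h3 : lapm K l' ≤ lapm K l := lapm_anti (dens_pos _) h
    gcongr
  have top_of : ∀ ρ : Measure ℝ, (∀ l l', l ≤ l' → lapm ρ l' ≤ lapm ρ l) →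
      (∀ l, 0 < l → lapm ρ l = ENNReal.ofReal (1 / l)) → ∀ l, l ≤ 0 → lapm ρ l = ⊤ := by
    intro ρ ha hp l hl
    by_contra hne
    set r := (lapm ρ l).toReal with hr
    have hr0 : 0 ≤ r := ENNReal.toReal_nonneg
    have h1 := ha l (1 / (r + 1)) (hl.trans (by positivity))
    rw [hp _ (by positivity), ENNReal.ofReal_le_iff_le_toReal hne, one_div_one_div] at h1
    linarith
  have hMeq : M = volume.restrict (Ioi 0) := by
    apply lapm_unique
    · intro l hl; rw [lMpos l hl]; exact ENNReal.ofReal_ne_top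
    · intro l
      rcases lt_or_ge 0 l with hl | hl
      · rw [lMpos l hl, lapm_vol hl]
      · rw [top_of M lManti lMpos l hl, top_of (volume.restrict (Ioi 0)) (fun l l' h =>
          lapm_anti (ae_restrict_mem measurableSet_Ioi) h) (fun l hl => lapm_vol hl) l hl]
  have hle : ENNReal.ofReal c • B ≤ volume.restrict (Ioi 0) := by
    rw [← hMeq, hM]
    exact Measure.le_add_right le_rfl
  have hae : (fun x => ENNReal.ofReal c * ENNReal.ofReal (W' x))
      ≤ᵐ[volume.restrict (Ioi 0)] fun _ => 1 := by
    apply ae_le_of_forall_setLIntegral_le_of_sigmaFinite (by fun_prop)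
    intro s hs _
    have := hle s
    rw [Measure.smul_apply, hB, withDensity_apply _ hs] at this
    rw [lintegral_const_mul _ (by fun_prop)]
    simpa using this
  intro t ht
  by_contra hlt
  push Not at hlt
  have hopen : IsOpen (Ioi (0:ℝ) ∩ W' ⁻¹' (Ioi (1 / c))) :=
    (hW'cont.mono Ioi_subset_Ici_self).isOpen_inter_preimage isOpen_Ioi isOpen_Ioi
  have hpos : 0 < volume (Ioi (0:ℝ) ∩ W' ⁻¹' (Ioi (1 / c))) := hopen.measure_pos _ ⟨t, ht, hlt⟩
  rw [EventuallyLE, ae_restrict_iff' measurableSet_Ioi] at hae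
  apply hpos.ne'
  refine measure_mono_null ?_ hae
  rintro x ⟨hx, hx2⟩ hcon
  have h1 := hcon hx
  rw [← ENNReal.ofReal_mul hc.le, ENNReal.ofReal_le_one] at h1
  have hx2 : 1 / c < W' x := hx2
  rw [div_lt_iff₀ hc] at hx2
  linarith

/-- Corollary: `W′(t) ≤ 1/c` for all `t ∈ ℝ`. -/
theorem stmt4
    (b c : ℝ) (hb : 0 ≤ b) (hc : 0 < c)
    (ν : Measure ℝ) (hν0 : ν (Set.Iic 0) = 0)
    (hνint : ∫⁻ y in Set.Ioi (0 : ℝ), ENNReal.ofReal (min y (y ^ 2)) ∂ν ≠ ⊤)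
    (W W' : ℝ → ℝ)
    (hWneg : ∀ x : ℝ, x < 0 → W x = 0)
    (hWnonneg : ∀ x : ℝ, 0 ≤ W x)
    (hWcont : ContinuousOn W (Set.Ici 0))
    (hWmono : StrictMonoOn W (Set.Ici 0))
    (hWlap : ∀ l : ℝ, 0 < l →
      (∫ x in Set.Ioi (0 : ℝ), Real.exp (-l * x) * W x) = 1 / phi b c ν l)
    (hW'neg : ∀ x : ℝ, x < 0 → W' x = 0)
    (hW'zero : W' 0 = 1 / c)
    (hW'deriv : ∀ x : ℝ, 0 < x → HasDerivAt W (W' x) x)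
    (hW'cont : ContinuousOn W' (Set.Ici 0))
    :
    ∀ t : ℝ, W' t ≤ 1 / c := by
  intro t
  rcases lt_trichotomy t 0 with h | h | h
  · rw [hW'neg t h]; positivity
  · rw [h, hW'zero]
  · exact main_aux b c hb hc ν hνint W W' hWneg hWnonneg hWcont hWmono hWlap hW'neg hW'deriv
      hW'cont t h
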